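/- Kalai's theorem: for positive integers $n$ and $d$ with $d \leq n-1$, $\sum_{T} |\tilde H_{d-1}(T;\mathbb{Z})|^2 = n^{\binom{n-2}{d}}$, where the sum is over all $d$-dimensional hypertrees $T$ on the labeled vertex set $[n]$. -/

import Mathlib

open Finset

variable {V : Type} [Fintype V] [LinearOrder V]

/-- Incidence number between a simplex `σ` and a codimension-one face `τ`:
`(-1)^i` where `i` is the position of the vertex `σ \ τ` in the increasing
ordering of `σ`, and `0` if `τ` is not a codimension-one face of `σ`. -/
def inc (σ τ : Finset V) : ℤ :=
  if τ ⊆ σ ∧ σ.card = τ.card + 1 then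
    ∑ v ∈ σ \ τ, (-1 : ℤ) ^ ((σ.filter (fun x => x < v)).card)
  else 0

/-- The augmented chain group of the simplicial complex `S` in (augmented) degree `k`:
the free module on the simplices of `S` having `k` vertices (so `k = 0` corresponds to
the empty simplex, and geometric dimension `k - 1`).  A basis simplex corresponds to the
oriented simplex `(v_0 v_1 ⋯)` with vertices listed in increasing order. -/
abbrev Chain (R : Type) [CommRing R] (S : Finset (Finset V)) (k : ℕ) : Type :=
  {σ : Finset V // σ ∈ S ∧ σ.card = k} → R

/-- The simplicial boundary map (augmented: in lowest degree it is the augmentation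
sending every vertex to `1`).  `bdry R S k : C_k → C_{k-1}` in the usual (geometric)
indexing of the paper. -/
def bdry (R : Type) [CommRing R] (S : Finset (Finset V)) (k : ℕ) :
    Chain R S (k + 1) →ₗ[R] Chain R S k :=
  LinearMap.pi fun τ => ∑ σ : {σ : Finset V // σ ∈ S ∧ σ.card = k + 1},
    (inc σ.1 τ.1 : R) • LinearMap.proj σ

/-- `S` is (the set of simplices of) a simplicial complex with vertex set `V`,
augmented with the empty simplex. -/
def IsComplex (S : Finset (Finset V)) : Prop :=
  ∅ ∈ S ∧ (∀ σ ∈ S, ∀ τ ⊆ σ, τ ∈ S) ∧ ∀ v : V, {v} ∈ S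

/-- The simplicial complex associated to a `(d+1)`-uniform hypergraph with edge set `E`:
the full `(d-1)`-skeleton on the vertex set together with the edges. -/
def cx (E : Finset (Finset V)) (d : ℕ) : Finset (Finset V) :=
  univ.filter (fun σ : Finset V => σ.card ≤ d) ∪ E

/-- The complex of the complete `(d+1)`-uniform hypergraph on `n` vertices. -/
def completeCx (n d : ℕ) : Finset (Finset (Fin n)) :=
  univ.filter (fun σ : Finset (Fin n) => σ.card ≤ d + 1)

/-- Coefficientwise inclusion of integral chains into real chains. -/
def castChain (S : Finset (Finset V)) (k : ℕ) : Chain ℤ S k →ₗ[ℤ] Chain ℝ S k :=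
  LinearMap.pi fun τ => ((Int.castAddHom ℝ).toIntLinearMap).comp (LinearMap.proj τ)

/-- The order of the group `H̃_{d-1}(T; ℤ) = Z_{d-1}(T; ℤ)/B_{d-1}(T; ℤ)` for the
`(d+1)`-uniform hypergraph with edge set `F`, where `d = k + 1`. -/
noncomputable def cardH (F : Finset (Finset V)) (k : ℕ) : ℕ :=
  Nat.card
    (LinearMap.ker (bdry ℤ (cx F (k + 1)) k) ⧸
      Submodule.comap (LinearMap.ker (bdry ℤ (cx F (k + 1)) k)).subtype
        (LinearMap.range (bdry ℤ (cx F (k + 1)) (k + 1))))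

/-- `F` is (the edge set of) a `d`-dimensional hypertree, where `d = k + 1`:
`H̃_d(F; ℝ) = 0` and `H̃_{d-1}(F; ℝ) = 0` (viewing `F` together with the full
`(d-1)`-skeleton as a simplicial complex). -/
def IsHypertree (F : Finset (Finset V)) (k : ℕ) : Prop :=
  LinearMap.ker (bdry ℝ (cx F (k + 1)) (k + 1)) = ⊥ ∧
    LinearMap.ker (bdry ℝ (cx F (k + 1)) k) = LinearMap.range (bdry ℝ (cx F (k + 1)) (k + 1))

/-- The sign `(-1)^i` where `i` is the number of elements of `σ` below `v`. -/
def posSign (v : V) (σ : Finset V) : ℤ := (-1) ^ (σ.filter (fun x => x < v)).card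

/-- The matrix of exterior multiplication by the vertex `v`. -/
def wedge (v : V) (ρ σ : Finset V) : ℤ :=
  if v ∉ σ ∧ ρ = insert v σ then posSign v σ else 0

set_option linter.unusedSectionVars false in
lemma posSign_mul_self (v : V) (σ : Finset V) : posSign v σ * posSign v σ = 1 := by
  unfold posSign
  rw [← pow_add, Even.neg_one_pow ⟨_, rfl⟩]

set_option linter.unusedSectionVars false in
lemma posSign_insert {v w : V} {σ : Finset V} (hv : v ∉ σ) :
    posSign w (insert v σ) = (if v < w then -1 else 1) * posSign w σ := by
  unfold posSign
  rw [Finset.filter_insert]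
  split_ifs with h
  · rw [Finset.card_insert_of_notMem (by simp [hv]), pow_succ]; ring
  · simp

set_option linter.unusedSectionVars false in
lemma posSign_erase {v w : V} {σ : Finset V} (hv : v ∈ σ) :
    posSign w (σ.erase v) = (if v < w then -1 else 1) * posSign w σ := by
  have h := posSign_insert (w := w) (Finset.notMem_erase v σ)
  rw [Finset.insert_erase hv] at h
  rw [h]
  split_ifs <;> ring

set_option linter.unusedSectionVars false in
lemma inc_eq_sum_wedge {W ρ : Finset V} (hρ : ρ ⊆ W) (σ : Finset V) :
    inc ρ σ = ∑ v ∈ W, wedge v ρ σ := by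
  unfold inc
  split_ifs with h
  · obtain ⟨a, ha, rfl⟩ := Finset.exists_eq_insert_iff.2 ⟨h.1, h.2.symm⟩
    have haW : a ∈ W := hρ (Finset.mem_insert_self _ _)
    rw [Finset.sum_eq_single_of_mem a haW]
    · have : insert a σ \ σ = {a} := by
        ext x; simp only [mem_sdiff, mem_insert, mem_singleton]; grind
      rw [this, Finset.sum_singleton]
      have h2 := posSign_insert (w := a) ha
      simp only [lt_irrefl, if_false, one_mul] at h2
      simpa [wedge, ha, posSign] using h2
    · intro b _ hb
      unfold wedge
      rw [if_neg]
      rintro ⟨hb1, hb2⟩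
      have : b ∈ insert a σ := hb2 ▸ Finset.mem_insert_self _ _
      grind
  · symm
    refine Finset.sum_eq_zero fun v _ => ?_
    unfold wedge
    rw [if_neg]
    rintro ⟨h1, rfl⟩
    exact h ⟨Finset.subset_insert _ _, Finset.card_insert_of_notMem h1⟩

lemma inc_insert {v : V} {σ : Finset V} (hv : v ∉ σ) : inc (insert v σ) σ = posSign v σ := by
  rw [inc_eq_sum_wedge (Finset.subset_univ _), Finset.sum_eq_single_of_mem v (mem_univ _)]
  · simp [wedge, hv]
  · intro b _ hb
    unfold wedge
    rw [if_neg]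
    rintro ⟨h1, h2⟩
    have : b ∈ insert v σ := h2 ▸ Finset.mem_insert_self _ _
    grind

set_option linter.unusedSectionVars false in
lemma subset_of_inc_ne_zero {ρ σ : Finset V} (h : inc ρ σ ≠ 0) :
    σ ⊆ ρ ∧ ρ.card = σ.card + 1 := by
  by_contra h'
  exact h (if_neg h')

lemma sum_wedge_left_mul (v : V) (σ : Finset V) (f : Finset V → ℤ) :
    ∑ ρ, wedge v ρ σ * f ρ = if v ∉ σ then posSign v σ * f (insert v σ) else 0 := by
  split_ifs with h
  · exact Finset.sum_eq_zero fun ρ _ => by simp [wedge, h]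
  · rw [Finset.sum_eq_single_of_mem (insert v σ) (mem_univ _)]
    · simp [wedge, h]
    · intro b _ hb; simp [wedge, hb]

lemma sum_wedge_right_mul (w : V) (σ : Finset V) (f : Finset V → ℤ) :
    ∑ ρ, wedge w σ ρ * f ρ = if w ∈ σ then posSign w σ * f (σ.erase w) else 0 := by
  split_ifs with h
  · rw [Finset.sum_eq_single_of_mem (σ.erase w) (mem_univ _)]
    · simp [wedge, Finset.insert_erase h, posSign_erase h]
    · intro b _ hb
      unfold wedge
      rw [if_neg, zero_mul]
      rintro ⟨h1, rfl⟩
      exact hb (Finset.erase_insert h1).symm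
  · refine Finset.sum_eq_zero fun ρ _ => ?_
    unfold wedge
    rw [if_neg, zero_mul]
    rintro ⟨h1, rfl⟩
    exact h (Finset.mem_insert_self _ _)

lemma wedge_anticomm_transpose (v w : V) (σ τ : Finset V) :
    ∑ ρ, wedge v ρ σ * wedge w ρ τ + ∑ ρ, wedge w σ ρ * wedge v τ ρ
      = if v = w ∧ σ = τ then 1 else 0 := by
  rw [sum_wedge_left_mul, sum_wedge_right_mul]
  by_cases hvw : v = w
  · subst hvw
    by_cases hv : v ∈ σ
    · have hw : wedge v τ (σ.erase v) = if σ = τ then posSign v σ else 0 := by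
        unfold wedge
        simp [Finset.insert_erase hv, posSign_erase hv, eq_comm]
      simp only [hv, not_true_eq_false, if_false, if_true, hw]
      split_ifs <;> simp_all [posSign_mul_self]
    · have hw : wedge v (insert v σ) τ = if σ = τ then posSign v σ else 0 := by
        unfold wedge
        by_cases h : σ = τ
        · subst h; simp [hv]
        · rw [if_neg, if_neg h]
          rintro ⟨h1, h2⟩
          apply h
          rw [← Finset.erase_insert hv, h2, Finset.erase_insert h1]
      simp only [hv, not_false_eq_true, if_false, if_true, hw]
      split_ifs <;> simp_all [posSign_mul_self]
  · rw [if_neg (show ¬ (v = w ∧ σ = τ) from fun h => hvw h.1)]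
    by_cases hv : v ∈ σ
    · have h1 : wedge v τ (σ.erase w) = 0 := by
        unfold wedge
        rw [if_neg]
        simp [hv, hvw]
      simp [hv, h1]
    · by_cases hw : w ∈ σ
      · have h1 : wedge w (insert v σ) τ
            = if τ = insert v (σ.erase w) then posSign w τ else 0 := by
          unfold wedge
          congr 1
          apply propext
          constructor
          · rintro ⟨h1, h2⟩
            rw [← Finset.erase_insert h1, ← h2, Finset.erase_insert_of_ne hvw]
          · rintro rfl
            grind
        have h2 : wedge v τ (σ.erase w)
            = if τ = insert v (σ.erase w) then posSign v (σ.erase w) else 0 := by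
          unfold wedge
          simp [hv]
        rw [h1, h2]
        simp only [hv, hw, not_false_eq_true, if_true]
        split_ifs with h
        · subst h
          rw [posSign_insert (by simp [hv]), posSign_erase hw, posSign_erase hw]
          rcases lt_or_gt_of_ne hvw with h | h
          · simp [h, not_lt_of_gt h]; ring
          · simp [h, not_lt_of_gt h]; ring
        · simp
      · have h1 : wedge w (insert v σ) τ = 0 := by
          unfold wedge
          rw [if_neg]
          rintro ⟨h1, h2⟩
          have : w ∈ insert v σ := h2 ▸ Finset.mem_insert_self _ _
          grind
        simp [hw, h1]

lemma wedge_anticomm (v w : V) (σ τ : Finset V) :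
    ∑ ρ, wedge v σ ρ * wedge w ρ τ + ∑ ρ, wedge w σ ρ * wedge v ρ τ = 0 := by
  rw [sum_wedge_right_mul, sum_wedge_right_mul]
  by_cases hτ : v ∉ τ ∧ w ∉ τ ∧ v ≠ w ∧ σ = insert v (insert w τ)
  · obtain ⟨hv, hw, hvw, rfl⟩ := hτ
    have h1 : (insert v (insert w τ)).erase v = insert w τ := by grind
    have h2 : (insert v (insert w τ)).erase w = insert v τ := by grind
    have h3 : posSign v (insert v (insert w τ)) = posSign v (insert w τ) := by
      rw [posSign_insert (by grind)]; simp
    have h4 : posSign w (insert v (insert w τ)) = posSign w (insert v τ) := by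
      rw [Finset.insert_comm, posSign_insert (by grind)]; simp
    rw [h1, h2, h3, h4, posSign_insert hv, posSign_insert hw]
    rcases lt_or_gt_of_ne hvw with h | h
    · simp [wedge, hv, hw, h, not_lt_of_gt h]; ring
    · simp [wedge, hv, hw, h, not_lt_of_gt h]; ring
  · have key : ∀ a b : V, (¬ (a ∉ τ ∧ b ∉ τ ∧ a ≠ b ∧ σ = insert a (insert b τ))) →
        (if a ∈ σ then posSign a σ * wedge b (σ.erase a) τ else 0) = 0 := by
      intro a b hab
      split_ifs with h
      · unfold wedge
        rw [if_neg, mul_zero]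
        rintro ⟨h1, h2⟩
        apply hab
        have ha : a ∉ insert b τ := h2 ▸ Finset.notMem_erase a σ
        refine ⟨by grind, h1, by grind, ?_⟩
        rw [← h2, Finset.insert_erase h]
      · rfl
    rw [key v w hτ, key w v, add_zero]
    rintro ⟨h1, h2, h3, h4⟩
    exact hτ ⟨h2, h1, h3.symm, by rw [h4, Finset.insert_comm]⟩

lemma sum_inc_mul_inc_eq_zero (σ τ : Finset V) : ∑ ρ, inc σ ρ * inc ρ τ = 0 := by
  have h : ∑ ρ, inc σ ρ * inc ρ τ = ∑ v, ∑ w, ∑ ρ, wedge v σ ρ * wedge w ρ τ := by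
    simp_rw [inc_eq_sum_wedge (Finset.subset_univ _), Finset.sum_mul_sum]
    rw [Finset.sum_comm]
    exact Finset.sum_congr rfl fun v _ => Finset.sum_comm
  have h2 : ∑ v : V, ∑ w : V, (∑ ρ, wedge v σ ρ * wedge w ρ τ + ∑ ρ, wedge w σ ρ * wedge v ρ τ)
      = 0 := by
    simp [wedge_anticomm]
  simp_rw [Finset.sum_add_distrib] at h2
  rw [Finset.sum_comm (f := fun v w => ∑ ρ, wedge w σ ρ * wedge v ρ τ), ← h] at h2
  linarith

/-- The full Laplacian of the complete complex on the vertex set `W` is scalar. -/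
lemma laplacian_eq {W σ τ : Finset V} (hσ : σ ⊆ W) (hτ : τ ⊆ W) :
    ∑ ρ ∈ W.powerset, inc ρ σ * inc ρ τ + ∑ ρ, inc σ ρ * inc τ ρ
      = if σ = τ then (W.card : ℤ) else 0 := by
  have h1 : ∑ ρ ∈ W.powerset, inc ρ σ * inc ρ τ
      = ∑ v ∈ W, ∑ w ∈ W, ∑ ρ, wedge v ρ σ * wedge w ρ τ := by
    have : ∑ ρ ∈ W.powerset, inc ρ σ * inc ρ τ
        = ∑ ρ, (∑ v ∈ W, wedge v ρ σ) * ∑ w ∈ W, wedge w ρ τ := by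
      rw [← Finset.sum_subset (Finset.subset_univ W.powerset)]
      · refine Finset.sum_congr rfl fun ρ hρ => ?_
        rw [Finset.mem_powerset] at hρ
        rw [inc_eq_sum_wedge hρ, inc_eq_sum_wedge hρ]
      · intro ρ _ hρ
        rw [Finset.sum_eq_zero, zero_mul]
        intro v hv
        unfold wedge
        rw [if_neg]
        rintro ⟨_, rfl⟩
        exact hρ (Finset.mem_powerset.2 (Finset.insert_subset hv hσ))
    rw [this]
    simp_rw [Finset.sum_mul_sum]
    rw [Finset.sum_comm]
    exact Finset.sum_congr rfl fun v _ => Finset.sum_comm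
  have h2 : ∑ ρ, inc σ ρ * inc τ ρ = ∑ v ∈ W, ∑ w ∈ W, ∑ ρ, wedge w σ ρ * wedge v τ ρ := by
    rw [Finset.sum_comm (s := W) (t := W)]
    simp_rw [inc_eq_sum_wedge hσ, inc_eq_sum_wedge hτ, Finset.sum_mul_sum]
    rw [Finset.sum_comm]
    exact Finset.sum_congr rfl fun v _ => Finset.sum_comm
  have h3 : ∀ v ∈ W, ∀ w ∈ W,
      ∑ ρ, wedge v ρ σ * wedge w ρ τ + ∑ ρ, wedge w σ ρ * wedge v τ ρ
        = if v = w ∧ σ = τ then 1 else 0 := fun v _ w _ => wedge_anticomm_transpose v w σ τ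
  rw [h1, h2, ← Finset.sum_add_distrib]
  simp_rw [← Finset.sum_add_distrib (s := W)]
  rw [Finset.sum_congr rfl fun v hv => Finset.sum_congr rfl (h3 v hv)]
  by_cases h : σ = τ <;> simp [h]

section CauchyBinet

variable {A ι : Type} [Fintype A] [DecidableEq A] [DecidableEq ι]

lemma sum_image_eq_det_sq (M : Matrix A ι ℤ) {F : Finset ι} (e : A ≃ F) :
    ∑ r ∈ Fintype.piFinset (fun _ : A => F) with univ.image r = F,
      (∏ i, M i (r i)) * (Matrix.of fun i j => M j (r i)).det
      = (M.submatrix id (fun a => (e a : ι))).det ^ 2 := by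
  have h : ∀ σ : Equiv.Perm A,
      (Matrix.of fun i j => M j (e (σ i) : ι)).det
        = Equiv.Perm.sign σ * (M.submatrix id (fun a => (e a : ι))).det := by
    intro σ
    have h2 := Matrix.det_permute σ (M.submatrix id (fun a => (e a : ι))).transpose
    rw [Matrix.det_transpose] at h2
    exact h2
  rw [pow_two]
  nth_rewrite 1 [← Matrix.det_transpose, Matrix.det_apply', Finset.sum_mul]
  symm
  refine Finset.sum_of_injOn (fun σ a => (e (σ a) : ι)) ?_ ?_ ?_ ?_
  · intro σ _ τ _ hστ
    ext a
    exact e.injective (Subtype.ext (congrFun hστ a))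
  · intro σ _
    simp only [coe_filter, Fintype.mem_piFinset, Set.mem_ofPred_eq]
    refine ⟨fun a => (e (σ a)).2, ?_⟩
    ext x
    simp only [mem_image, mem_univ, true_and]
    constructor
    · rintro ⟨a, rfl⟩; exact (e (σ a)).2
    · intro hx; exact ⟨σ.symm (e.symm ⟨x, hx⟩), by simp⟩
  · intro r hr hr'
    exfalso
    apply hr'
    simp only [mem_filter, Fintype.mem_piFinset] at hr
    have hs : Function.Surjective (fun a => e.symm ⟨r a, hr.1 a⟩) := by
      intro b
      have hb : (e b : ι) ∈ univ.image r := hr.2 ▸ (e b).2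
      obtain ⟨a, -, ha⟩ := Finset.mem_image.1 hb
      exact ⟨a, by simp [ha]⟩
    refine ⟨Equiv.ofBijective _ (Finite.surjective_iff_bijective.1 hs), by simp, ?_⟩
    ext a
    simp
  · intro σ _
    rw [h]
    simp only [Matrix.transpose_apply, Matrix.submatrix_apply, id, Int.cast_id]
    ring

lemma sum_image_eq_zero (M : Matrix A ι ℤ) {F : Finset ι} (e : IsEmpty (A ≃ F)) :
    ∑ r ∈ Fintype.piFinset (fun _ : A => F) with univ.image r = F,
      (∏ i, M i (r i)) * (Matrix.of fun i j => M j (r i)).det = 0 := by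
  refine Finset.sum_eq_zero fun r hr => ?_
  simp only [mem_filter, Fintype.mem_piFinset] at hr
  by_cases hinj : Function.Injective r
  · refine (e.false (Equiv.ofBijective (fun a => ⟨r a, hr.1 a⟩) ⟨?_, ?_⟩)).elim
    · intro a b hab
      exact hinj (congrArg Subtype.val hab)
    · rintro ⟨x, hx⟩
      rw [← hr.2] at hx
      obtain ⟨a, -, rfl⟩ := Finset.mem_image.1 hx
      exact ⟨a, rfl⟩
  · obtain ⟨a, b, hab, hne⟩ : ∃ a b, r a = r b ∧ a ≠ b := by
      simpa [Function.Injective] using hinj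
    rw [Matrix.det_zero_of_row_eq hne, mul_zero]
    ext j
    simp [hab]

open scoped Classical in
/-- The Cauchy–Binet formula for the Gram determinant of the rows of `M`. -/
lemma det_gram_eq_sum (M : Matrix A ι ℤ) (E : Finset ι) :
    (Matrix.of fun i j => ∑ c ∈ E, M i c * M j c).det
      = ∑ F ∈ E.powerset, if h : Nonempty (A ≃ F) then
          (M.submatrix id (fun a => (h.some a : ι))).det ^ 2 else 0 := by
  have h1 : (Matrix.of fun i j => ∑ c ∈ E, M i c * M j c).det
      = ∑ r ∈ Fintype.piFinset (fun _ : A => E),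
        (∏ i, M i (r i)) * (Matrix.of fun i j => M j (r i)).det := by
    have := (Matrix.detRowAlternating (n := A) (R := ℤ)).toMultilinearMap.map_sum_finset
      (fun i c => M i c • fun j => M j c) (fun _ => E)
    simp only [MultilinearMap.map_smul_univ] at this
    convert this using 1
    · refine congrArg Matrix.det ?_
      ext i j
      simp [Finset.sum_apply]
    · rfl
  rw [h1, ← Finset.sum_fiberwise_of_maps_to (s := Fintype.piFinset (fun _ : A => E))
    (t := E.powerset) (g := fun r => univ.image r)]
  · refine Finset.sum_congr rfl fun F hF => ?_
    rw [Finset.mem_powerset] at hF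
    have h2 : (Fintype.piFinset (fun _ : A => E)).filter (fun r => univ.image r = F)
        = (Fintype.piFinset (fun _ : A => F)).filter (fun r => univ.image r = F) := by
      ext r
      simp only [mem_filter, Fintype.mem_piFinset, and_congr_left_iff]
      rintro rfl
      exact ⟨fun _ a => Finset.mem_image_of_mem _ (mem_univ a), fun h a => hF (h a)⟩
    rw [h2]
    split_ifs with h
    · exact sum_image_eq_det_sq M h.some
    · exact sum_image_eq_zero M (not_nonempty_iff.1 h)
  · intro r hr
    rw [Fintype.mem_piFinset] at hr
    rw [Finset.mem_powerset]
    intro x hx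
    obtain ⟨a, -, rfl⟩ := Finset.mem_image.1 hx
    exact hr a

end CauchyBinet

/-- The `j`-element subsets of `W`. -/
abbrev Faces (W : Finset V) (j : ℕ) : Type := {σ : Finset V // σ ⊆ W ∧ σ.card = j}

/-- The boundary matrix of the complete complex on the vertex set `W`. -/
def bdryMatrix (W : Finset V) (j : ℕ) : Matrix (Faces W j) (Faces W (j + 1)) ℤ :=
  Matrix.of fun τ σ => inc σ.1 τ.1

lemma card_faces (W : Finset V) (j : ℕ) : Fintype.card (Faces W j) = W.card.choose j := by
  rw [← Finset.card_powersetCard, Fintype.card_subtype]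
  congr 1
  ext σ
  simp [Finset.mem_powersetCard]

lemma sum_faces {W : Finset V} {j : ℕ} {f : Finset V → ℤ} (U : Finset (Finset V))
    (hU : U ⊆ W.powerset) (h : ∀ ρ ∈ W.powerset, f ρ ≠ 0 → ρ.card = j ∧ ρ ∈ U) :
    ∑ ρ : Faces W j, f ρ.1 = ∑ ρ ∈ U, f ρ := by
  rw [← Finset.sum_subtype (W.powersetCard j) (by simp [Finset.mem_powersetCard]) f]
  rw [← Finset.sum_filter_ne_zero, ← Finset.sum_filter_ne_zero (s := U)]
  refine Finset.sum_congr ?_ fun _ _ => rfl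
  ext ρ
  have := h ρ
  have h' := @hU ρ
  simp only [mem_filter, Finset.mem_powersetCard, Finset.mem_powerset] at *
  grind

lemma sum_faces_inc_mul_inc_transpose {W : Finset V} {j : ℕ} (σ τ : Faces W j) :
    ∑ ρ : Faces W (j + 1), inc ρ.1 σ.1 * inc ρ.1 τ.1
      = ∑ ρ ∈ W.powerset, inc ρ σ.1 * inc ρ τ.1 := by
  refine sum_faces (f := fun ρ => inc ρ σ.1 * inc ρ τ.1) _ subset_rfl fun ρ hρ h => ?_
  exact ⟨by rw [(subset_of_inc_ne_zero (left_ne_zero_of_mul h)).2, σ.2.2], hρ⟩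

lemma sum_faces_inc_mul_inc {W : Finset V} {j : ℕ} (σ τ : Faces W (j + 1)) :
    ∑ ρ : Faces W j, inc σ.1 ρ.1 * inc τ.1 ρ.1 = ∑ ρ, inc σ.1 ρ * inc τ.1 ρ := by
  rw [sum_faces (f := fun ρ => inc σ.1 ρ * inc τ.1 ρ) _ subset_rfl]
  · refine Finset.sum_subset (Finset.subset_univ _) fun ρ _ hρ => ?_
    by_contra h
    exact hρ (Finset.mem_powerset.2
      ((subset_of_inc_ne_zero (left_ne_zero_of_mul h)).1.trans σ.2.1))
  · intro ρ hρ h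
    have := (subset_of_inc_ne_zero (left_ne_zero_of_mul h)).2
    exact ⟨by have := σ.2.2; omega, hρ⟩

lemma bdryMatrix_mul_transpose_add (W : Finset V) (j : ℕ) :
    bdryMatrix W (j + 1) * (bdryMatrix W (j + 1)).transpose
      + (bdryMatrix W j).transpose * bdryMatrix W j = (W.card : ℤ) • 1 := by
  ext σ τ
  have h := laplacian_eq σ.2.1 τ.2.1
  have h1 := sum_faces_inc_mul_inc_transpose σ τ
  have h2 := sum_faces_inc_mul_inc σ τ
  simp only [Matrix.add_apply, Matrix.mul_apply, Matrix.transpose_apply, bdryMatrix,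
    Matrix.of_apply, Matrix.smul_apply, Matrix.one_apply, h1, h2, h, Subtype.ext_iff]
  simp

lemma bdryMatrix_zero_mul_transpose (W : Finset V) :
    bdryMatrix W 0 * (bdryMatrix W 0).transpose = (W.card : ℤ) • 1 := by
  ext σ τ
  have h := laplacian_eq σ.2.1 τ.2.1
  have h1 := sum_faces_inc_mul_inc_transpose σ τ
  have h2 : ∑ ρ, inc σ.1 ρ * inc τ.1 ρ = 0 := by
    refine Finset.sum_eq_zero fun ρ _ => ?_
    by_contra h
    have := (subset_of_inc_ne_zero (left_ne_zero_of_mul h)).2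
    have := σ.2.2
    omega
  rw [h2, add_zero] at h
  simp only [Matrix.mul_apply, Matrix.transpose_apply, bdryMatrix,
    Matrix.of_apply, Matrix.smul_apply, Matrix.one_apply, h1, h, Subtype.ext_iff]
  simp

lemma det_scalar_sub_mul_comm {m n : Type} [Fintype m] [Fintype n] [DecidableEq m]
    [DecidableEq n] (A : Matrix m n ℤ) (B : Matrix n m ℤ) (t : ℤ) :
    t ^ Fintype.card n * (t • 1 - A * B).det = t ^ Fintype.card m * (t • 1 - B * A).det := by
  have h := congrArg (Polynomial.eval t) (Matrix.charpoly_mul_comm' A B)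
  simpa only [Polynomial.eval_mul, Polynomial.eval_pow, Polynomial.eval_X, Matrix.eval_charpoly,
    ← Matrix.smul_one_eq_diagonal, Matrix.scalar_apply] using h

lemma det_sub_transpose_mul_bdryMatrix (W : Finset V) {m : ℕ} (hW : W.card = m + 1) (j : ℕ) :
    (((m : ℤ) + 2) • (1 : Matrix (Faces W (j + 1)) _ ℤ)
      - (bdryMatrix W j).transpose * bdryMatrix W j).det = ((m : ℤ) + 2) ^ m.choose (j + 1) := by
  have hn : ((m : ℤ) + 2) ≠ 0 := by positivity
  induction j using Nat.twoStepInduction with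
  | zero =>
    have h := det_scalar_sub_mul_comm (bdryMatrix W 0).transpose (bdryMatrix W 0) ((m : ℤ) + 2)
    rw [bdryMatrix_zero_mul_transpose, hW, ← sub_smul, card_faces, card_faces, hW] at h
    have h1 : ((m : ℤ) + 2 - (m + 1 : ℕ)) = 1 := by push_cast; ring
    rw [h1, one_smul, Matrix.det_one, Nat.choose_zero_right] at h
    apply mul_left_cancel₀ (pow_ne_zero 1 hn)
    rw [h]
    simp [pow_succ, mul_comm]
  | one =>
    have h := det_scalar_sub_mul_comm (bdryMatrix W 1).transpose (bdryMatrix W 1) ((m : ℤ) + 2)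
    have h0 : bdryMatrix W 1 * (bdryMatrix W 1).transpose = _ :=
      eq_sub_of_add_eq (bdryMatrix_mul_transpose_add W 0)
    have h2 : ((m : ℤ) + 2) • 1 - bdryMatrix W 1 * (bdryMatrix W 1).transpose
        = 1 + (bdryMatrix W 0).transpose * bdryMatrix W 0 := by
      rw [h0, hW]
      push_cast
      module
    have h3 : (1 + (bdryMatrix W 0).transpose * bdryMatrix W 0).det = (m : ℤ) + 2 := by
      rw [Matrix.det_one_add_mul_comm, bdryMatrix_zero_mul_transpose, hW]
      have : (1 : Matrix (Faces W 0) (Faces W 0) ℤ) + ((m + 1 : ℕ) : ℤ) • 1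
        = ((m : ℤ) + 2) • 1 := by push_cast; module
      rw [this, Matrix.det_smul, Matrix.det_one, card_faces]
      simp
    rw [h2, h3, card_faces, card_faces, hW] at h
    apply mul_left_cancel₀ (pow_ne_zero _ hn)
    rw [h, ← pow_add, ← pow_succ]
    congr 1
    simp [Nat.choose_succ_succ' m 1]
    ring
  | more j ih _ =>
    have h := det_scalar_sub_mul_comm (bdryMatrix W (j + 2)).transpose (bdryMatrix W (j + 2))
      ((m : ℤ) + 2)
    have h0 := bdryMatrix_mul_transpose_add W (j + 1)
    have h2 : ((m : ℤ) + 2) • 1 - bdryMatrix W (j + 2) * (bdryMatrix W (j + 2)).transpose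
        = 1 + (bdryMatrix W (j + 1)).transpose * bdryMatrix W (j + 1) := by
      rw [eq_sub_of_add_eq h0, hW]
      push_cast
      module
    have h3 : (1 + (bdryMatrix W (j + 1)).transpose * bdryMatrix W (j + 1)).det
        = ((m : ℤ) + 2) ^ m.choose (j + 1) := by
      rw [Matrix.det_one_add_mul_comm, ← ih, eq_sub_of_add_eq (bdryMatrix_mul_transpose_add W j),
        hW]
      congr 1
      push_cast
      module
    rw [h2, h3, card_faces, card_faces, hW] at h
    apply mul_left_cancel₀ (pow_ne_zero _ hn)
    rw [h, ← pow_add, ← pow_add]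
    congr 1
    rw [Nat.choose_succ_succ' m (j + 2), Nat.choose_succ_succ' m (j + 1)]
    ring

section Reduction

variable {F : Finset (Finset V)} {k : ℕ} (R : Type) [CommRing R]

lemma mem_cx_of_card_le {σ : Finset V} {d : ℕ} (h : σ.card ≤ d) : σ ∈ cx F d :=
  Finset.mem_union_left _ (by simpa using h)

lemma mem_cx_and_card_iff (hF : ∀ σ ∈ F, σ.card = k + 2) (σ : Finset V) :
    σ ∈ cx F (k + 1) ∧ σ.card = k + 1 + 1 ↔ σ ∈ F := by
  simp only [cx, mem_union, mem_filter, mem_univ, true_and]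
  constructor
  · rintro ⟨h1 | h1, h2⟩
    · omega
    · exact h1
  · intro h
    exact ⟨Or.inr h, hF σ h⟩

lemma bdry_apply (S : Finset (Finset V)) (j : ℕ) (c : Chain R S (j + 1))
    (τ : {τ : Finset V // τ ∈ S ∧ τ.card = j}) :
    bdry R S j c τ = ∑ σ : {σ : Finset V // σ ∈ S ∧ σ.card = j + 1}, (inc σ.1 τ.1 : R) * c σ := by
  simp [bdry]

lemma sum_cx_inc_mul_inc_eq_zero (ρ τ : Finset V) (hρ : ρ.card = k + 2) :
    ∑ σ : {σ : Finset V // σ ∈ cx F (k + 1) ∧ σ.card = k + 1},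
      (inc σ.1 τ : R) * (inc ρ σ.1 : R) = 0 := by
  have h := sum_inc_mul_inc_eq_zero ρ τ
  rw [← Finset.sum_subset (Finset.subset_univ (univ.powersetCard (k + 1)))] at h
  · rw [Finset.sum_subtype (p := fun σ => σ ∈ cx F (k + 1) ∧ σ.card = k + 1)
      (univ.powersetCard (k + 1))] at h
    · have h' := congrArg (Int.cast : ℤ → R) h
      push_cast at h'
      rw [← h']
      exact Finset.sum_congr rfl fun _ _ => mul_comm _ _
    · intro σ
      simp only [Finset.mem_powersetCard, Finset.subset_univ, true_and]
      exact ⟨fun h => ⟨mem_cx_of_card_le h.le, h⟩, fun h => h.2⟩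
  · intro σ _ hσ
    by_contra h0
    apply hσ
    have := (subset_of_inc_ne_zero (left_ne_zero_of_mul h0)).2
    simp only [Finset.mem_powersetCard, Finset.subset_univ, true_and]
    omega

lemma bdry_sum_inc_mul {ι : Type} [Fintype ι] (g : ι → Finset V) (hg : ∀ i, (g i).card = k + 2)
    (y : ι → R) :
    bdry R (cx F (k + 1)) k (fun σ => ∑ i, (inc (g i) σ.1 : R) * y i) = 0 := by
  ext τ
  rw [bdry_apply]
  simp_rw [Finset.mul_sum, ← mul_assoc]
  rw [Finset.sum_comm]
  refine Finset.sum_eq_zero fun i _ => ?_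
  rw [← Finset.sum_mul, sum_cx_inc_mul_inc_eq_zero R _ _ (hg i), zero_mul]

lemma range_bdry_le_ker :
    LinearMap.range (bdry R (cx F (k + 1)) (k + 1)) ≤ LinearMap.ker (bdry R (cx F (k + 1)) k) := by
  rintro _ ⟨c, rfl⟩
  rw [LinearMap.mem_ker, ← bdry_sum_inc_mul R (fun σ => σ.1) (fun σ => σ.2.2) c]
  congr 1
  ext τ
  rw [bdry_apply]

/-- Restriction of `k`-dimensional chains to the simplices contained in `W`. -/
def restrictFaces (F : Finset (Finset V)) (k : ℕ) (W : Finset V) :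
    Chain R (cx F (k + 1)) (k + 1) →ₗ[R] (Faces W (k + 1) → R) :=
  LinearMap.funLeft R R fun a => ⟨a.1, mem_cx_of_card_le a.2.2.le, a.2.2⟩

variable {v₀ : V}

set_option linter.unusedSectionVars false in
lemma posSign_of_isBot (hv₀ : ∀ v, v₀ ≤ v) (σ : Finset V) : posSign v₀ σ = 1 := by
  unfold posSign
  rw [Finset.filter_false_of_mem fun x _ => not_lt.2 (hv₀ x)]
  simp

lemma inc_insert_face (hv₀ : ∀ v, v₀ ≤ v) (a b : Faces (univ.erase v₀) (k + 1)) :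
    inc (insert v₀ a.1) b.1 = if a = b then 1 else 0 := by
  have ha : v₀ ∉ a.1 := fun h => Finset.notMem_erase v₀ univ (a.2.1 h)
  have hb : v₀ ∉ b.1 := fun h => Finset.notMem_erase v₀ univ (b.2.1 h)
  split_ifs with h
  · rw [h, inc_insert hb, posSign_of_isBot hv₀]
  · by_contra h0
    apply h
    have hs := (subset_of_inc_ne_zero h0).1
    rw [Finset.subset_insert_iff_of_notMem hb] at hs
    exact Subtype.ext (Finset.eq_of_subset_of_card_le hs (by rw [a.2.2, b.2.2])).symm

/-- The `k`-cycles are freely determined by their values on simplices avoiding the cone point. -/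
lemma restrictFaces_ker_bijective (hv₀ : ∀ v, v₀ ≤ v) :
    Function.Bijective ((restrictFaces R F k (univ.erase v₀)).domRestrict
      (LinearMap.ker (bdry R (cx F (k + 1)) k))) := by
  constructor
  · rw [← LinearMap.ker_eq_bot, LinearMap.ker_eq_bot']
    rintro ⟨z, hz⟩ hr
    have h0 : ∀ σ : {σ : Finset V // σ ∈ cx F (k + 1) ∧ σ.card = k + 1}, v₀ ∉ σ.1 → z σ = 0 := by
      intro σ hσ
      exact congrFun hr ⟨σ.1, Finset.subset_erase.2 ⟨Finset.subset_univ _, hσ⟩, σ.2.2⟩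
    refine Subtype.ext (funext fun τ => ?_)
    by_cases hτ : v₀ ∈ τ.1
    · have hcard : (τ.1.erase v₀).card = k := by
        rw [Finset.card_erase_of_mem hτ, τ.2.2]; rfl
      have h1 := congrFun (LinearMap.mem_ker.1 hz)
        ⟨τ.1.erase v₀, mem_cx_of_card_le (by omega), hcard⟩
      rw [bdry_apply, Finset.sum_eq_single_of_mem τ (mem_univ _)] at h1
      · have h2 := inc_insert (Finset.notMem_erase v₀ τ.1)
        rw [Finset.insert_erase hτ, posSign_of_isBot hv₀] at h2
        simpa [h2] using h1
      · intro σ _ hσ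
        by_cases hs : v₀ ∈ σ.1
        · have : inc σ.1 (τ.1.erase v₀) = 0 := by
            by_contra hne
            apply hσ
            have h3 := (subset_of_inc_ne_zero hne).1
            have h4 : τ.1 ⊆ σ.1 := by
              rw [← Finset.insert_erase hτ]
              exact Finset.insert_subset hs h3
            exact Subtype.ext
              (Finset.eq_of_subset_of_card_le h4 (by rw [σ.2.2, τ.2.2])).symm
          rw [this]; simp
        · rw [h0 σ hs, mul_zero]
    · exact h0 τ hτ
  · intro y
    have hcard : ∀ a : Faces (univ.erase v₀) (k + 1), (insert v₀ a.1).card = k + 2 := by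
      intro a
      rw [Finset.card_insert_of_notMem fun h => Finset.notMem_erase v₀ univ (a.2.1 h), a.2.2]
    refine ⟨⟨_, LinearMap.mem_ker.2 (bdry_sum_inc_mul R _ hcard y)⟩, ?_⟩
    ext b
    simp [restrictFaces, LinearMap.funLeft_apply, inc_insert_face hv₀]

/-- The boundary map followed by restriction to the simplices avoiding the cone point. -/
def reducedBdry (F : Finset (Finset V)) (k : ℕ) (v₀ : V) :
    Chain R (cx F (k + 1)) (k + 1 + 1) →ₗ[R] (Faces (univ.erase v₀) (k + 1) → R) :=
  restrictFaces R F k (univ.erase v₀) ∘ₗ bdry R (cx F (k + 1)) (k + 1)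

lemma isHypertree_iff_bijective (hv₀ : ∀ v, v₀ ≤ v) :
    IsHypertree F k ↔ Function.Bijective (reducedBdry ℝ F k v₀) := by
  have hbij := restrictFaces_ker_bijective (F := F) (k := k) ℝ hv₀
  have hle := range_bdry_le_ker (F := F) (k := k) ℝ
  unfold IsHypertree
  constructor
  · rintro ⟨h1, h2⟩
    rw [LinearMap.ker_eq_bot] at h1
    constructor
    · intro x y hxy
      apply h1
      have := @hbij.1 ⟨_, hle ⟨x, rfl⟩⟩ ⟨_, hle ⟨y, rfl⟩⟩ hxy
      exact congrArg Subtype.val this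
    · intro y
      obtain ⟨⟨z, hz⟩, rfl⟩ := hbij.2 y
      rw [h2] at hz
      obtain ⟨c, rfl⟩ := hz
      exact ⟨c, rfl⟩
  · rintro ⟨h1, h2⟩
    constructor
    · rw [LinearMap.ker_eq_bot]
      intro x y hxy
      apply h1
      simp only [reducedBdry, LinearMap.comp_apply, hxy]
    · refine le_antisymm ?_ hle
      intro z hz
      obtain ⟨c, hc⟩ := h2 (restrictFaces ℝ F k (univ.erase v₀) z)
      have := @hbij.1 ⟨_, hle ⟨c, rfl⟩⟩ ⟨z, hz⟩ hc
      exact ⟨c, congrArg Subtype.val this⟩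

lemma cardH_eq_card_quotient (hv₀ : ∀ v, v₀ ≤ v) :
    cardH F k = Nat.card ((Faces (univ.erase v₀) (k + 1) → ℤ) ⧸
      LinearMap.range (reducedBdry ℤ F k v₀)) := by
  let e := LinearEquiv.ofBijective _ (restrictFaces_ker_bijective (F := F) (k := k) ℤ hv₀)
  refine Nat.card_congr (Submodule.Quotient.equiv _ _ e ?_).toEquiv
  ext y
  constructor
  · rintro ⟨z, ⟨c, hc⟩, rfl⟩
    refine ⟨c, ?_⟩
    simp only [reducedBdry, LinearMap.comp_apply, hc]
    rfl
  · rintro ⟨c, rfl⟩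
    exact ⟨⟨_, range_bdry_le_ker ℤ ⟨c, rfl⟩⟩, ⟨c, rfl⟩, rfl⟩

/-- The boundary matrix with rows the simplices avoiding `v₀` and columns all sets of vertices. -/
def reducedMatrix (v₀ : V) (k : ℕ) : Matrix (Faces (univ.erase v₀) (k + 1)) (Finset V) ℤ :=
  Matrix.of fun a σ => inc σ a.1

lemma reducedBdry_eq (hF : ∀ σ ∈ F, σ.card = k + 2) (e : Faces (univ.erase v₀) (k + 1) ≃ F) :
    ∃ e' : Chain R (cx F (k + 1)) (k + 1 + 1) ≃ₗ[R] (Faces (univ.erase v₀) (k + 1) → R),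
      reducedBdry R F k v₀ = Matrix.toLin'
        (((reducedMatrix v₀ k).submatrix id fun a => (e a : Finset V)).map (Int.cast : ℤ → R))
          ∘ₗ e'.toLinearMap := by
  let f : Faces (univ.erase v₀) (k + 1) ≃
      {σ : Finset V // σ ∈ cx F (k + 1) ∧ σ.card = k + 1 + 1} :=
    e.trans (Equiv.subtypeEquivRight fun σ => (mem_cx_and_card_iff hF σ).symm)
  refine ⟨LinearEquiv.funCongrLeft R R f, ?_⟩
  refine LinearMap.ext fun c => funext fun a => ?_
  simp only [reducedBdry, restrictFaces, LinearMap.comp_apply, LinearMap.funLeft_apply,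
    bdry_apply, Matrix.toLin'_apply, Matrix.mulVec, dotProduct]
  rw [← f.sum_comp]
  rfl

lemma nonempty_equiv_of_bijective (hF : ∀ σ ∈ F, σ.card = k + 2)
    (h : Function.Bijective (reducedBdry ℝ F k v₀)) :
    Nonempty (Faces (univ.erase v₀) (k + 1) ≃ F) := by
  have h1 := (LinearEquiv.ofBijective _ h).finrank_eq
  rw [Module.finrank_fintype_fun_eq_card, Module.finrank_fintype_fun_eq_card] at h1
  exact ⟨(Fintype.equivOfCardEq h1.symm).trans
    (Equiv.subtypeEquivRight fun σ => mem_cx_and_card_iff hF σ)⟩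

lemma card_quotient_range_toLin' {A : Type} [Fintype A] [DecidableEq A] (N : Matrix A A ℤ)
    (hN : N.det ≠ 0) :
    Nat.card ((A → ℤ) ⧸ LinearMap.range (Matrix.toLin' N)) = N.det.natAbs := by
  have hinj : Function.Injective (Matrix.toLin' N) := Matrix.mulVec_injective_of_det_ne_zero hN
  rw [← Submodule.natAbs_det_equiv _ (LinearEquiv.ofInjective _ hinj), ← LinearMap.det_toLin']
  rfl

lemma bijective_toLin'_map_iff {A : Type} [Fintype A] [DecidableEq A] (N : Matrix A A ℤ) :
    Function.Bijective (Matrix.toLin' (N.map (Int.cast : ℤ → ℝ))) ↔ N.det ≠ 0 := by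
  have h : (N.map (Int.cast : ℤ → ℝ)).det = (N.det : ℝ) := (Int.cast_det N).symm
  rw [← Module.End.isUnit_iff, LinearMap.isUnit_iff_isUnit_det, LinearMap.det_toLin', h]
  simp

open scoped Classical in
lemma hypertree_weight_eq (hv₀ : ∀ v, v₀ ≤ v) (hF : ∀ σ ∈ F, σ.card = k + 2) :
    ((if IsHypertree F k then cardH F k ^ 2 else 0 : ℕ) : ℤ)
      = if h : Nonempty (Faces (univ.erase v₀) (k + 1) ≃ F) then
          ((reducedMatrix v₀ k).submatrix id (fun a => (h.some a : Finset V))).det ^ 2 else 0 := by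
  rw [isHypertree_iff_bijective hv₀]
  by_cases h : Nonempty (Faces (univ.erase v₀) (k + 1) ≃ F)
  · rw [dif_pos h]
    set N := (reducedMatrix v₀ k).submatrix id (fun a => (h.some a : Finset V)) with hN
    have hiff : Function.Bijective (reducedBdry ℝ F k v₀) ↔ N.det ≠ 0 := by
      obtain ⟨e', he'⟩ := reducedBdry_eq ℝ hF h.some
      rw [← bijective_toLin'_map_iff, he', LinearMap.coe_comp]
      exact e'.bijective.of_comp_iff _
    rw [hiff]
    split_ifs with hdet
    · obtain ⟨e', he'⟩ := reducedBdry_eq ℤ hF h.some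
      rw [cardH_eq_card_quotient hv₀, he', LinearEquiv.range_comp]
      have : N.map (Int.cast : ℤ → ℤ) = N := by ext; simp
      rw [← hN, this, card_quotient_range_toLin' N hdet]
      simp
    · simp_all
  · rw [dif_neg h, if_neg fun hb => h (nonempty_equiv_of_bijective hF hb)]
    rfl

end Reduction

lemma sum_inc_mul_inc_eq_gram (v₀ : V) (k : ℕ) :
    (Matrix.of fun a b => ∑ σ ∈ univ.filter (fun σ : Finset V => σ.card = k + 2),
        reducedMatrix v₀ k a σ * reducedMatrix v₀ k b σ)
      = (Fintype.card V : ℤ) • 1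
        - (bdryMatrix (univ.erase v₀) k).transpose * bdryMatrix (univ.erase v₀) k := by
  ext a b
  have h := laplacian_eq (Finset.subset_univ a.1) (Finset.subset_univ b.1)
  have h1 : ∑ σ ∈ univ.filter (fun σ : Finset V => σ.card = k + 2), inc σ a.1 * inc σ b.1
      = ∑ σ ∈ univ.powerset, inc σ a.1 * inc σ b.1 := by
    refine Finset.sum_subset (by simp) fun σ _ hσ => ?_
    by_contra h0
    apply hσ
    have := (subset_of_inc_ne_zero (left_ne_zero_of_mul h0)).2
    simpa [a.2.2] using this
  have h2 := sum_faces_inc_mul_inc a b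
  simp only [Matrix.of_apply, reducedMatrix, Matrix.sub_apply, Matrix.smul_apply, Matrix.one_apply,
    Matrix.mul_apply, Matrix.transpose_apply, bdryMatrix, h1, h2, Subtype.ext_iff]
  rw [eq_sub_iff_add_eq, h]
  simp

open scoped Classical in
/-- (Kalai) For positive integers `n` and `d` with `d ≤ n - 1`
(here `d = k + 1`), summing `|H̃_{d-1}(T; ℤ)|²` over all `d`-dimensional hypertrees
`T` on the labeled vertex set `[n]` gives `n ^ (n-2).choose d`. -/
theorem kalai (n d k : ℕ) (hdk : d = k + 1) (hn : 1 ≤ n) (hd : d ≤ n - 1) :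
    ∑ F ∈ (Finset.univ.filter
        (fun σ : Finset (Fin n) => σ.card = d + 1)).powerset,
      (if IsHypertree F k then cardH F k ^ 2 else 0)
      = n ^ (n - 2).choose d := by
  subst hdk
  obtain ⟨m, rfl⟩ : ∃ m, n = m + 2 := ⟨n - 2, by omega⟩
  have hv₀ : ∀ v : Fin (m + 2), 0 ≤ v := Fin.zero_le
  have hgram := det_gram_eq_sum (reducedMatrix (0 : Fin (m + 2)) k)
    (univ.filter (fun σ : Finset (Fin (m + 2)) => σ.card = k + 2))
  have hdet := det_sub_transpose_mul_bdryMatrix (univ.erase (0 : Fin (m + 2))) (m := m)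
    (by simp) k
  rw [sum_inc_mul_inc_eq_gram, Fintype.card_fin] at hgram
  push_cast at hgram
  rw [hdet] at hgram
  rw [Nat.add_sub_cancel, ← Nat.cast_inj (R := ℤ), Nat.cast_sum, Nat.cast_pow]
  rw [Nat.cast_add, Nat.cast_ofNat, hgram]
  refine Finset.sum_congr rfl fun F hF => ?_
  rw [← hypertree_weight_eq hv₀]
  · intro σ hσ
    simpa using Finset.mem_powerset.1 hF hσ
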